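/- For every real ε > 0 there exists N such that for every integer n ≥ N there exists an n-uniform hypergraph with at most (1 + ε) · (e · ln 2 / 4) · n² · 2^n edges that admits no proper 2-colouring. In other words, m(n) ≤ (1 + o(1)) · (e ln 2 / 4) · n² · 2^n. -/

import Mathlib

open Finset in
/-- Greedy covering: if every `a ∈ A` is related to at least a proportion `p` of `X`, then some
`m` elements of `X` leave at most a proportion `(1 - p) ^ m` of `A` uncovered. -/
theorem exists_greedy_cover {α β : Type*} [DecidableEq β] (A : Finset α) (X : Finset β)
    (hX : X.Nonempty) (r : α → β → Prop) [∀ a x, Decidable (r a x)] {p : ℝ} (hp1 : p ≤ 1)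
    (h : ∀ a ∈ A, p * #X ≤ #{x ∈ X | r a x}) (m : ℕ) :
    ∃ S ⊆ X, #S ≤ m ∧ (#{a ∈ A | ∀ x ∈ S, ¬ r a x} : ℝ) ≤ (1 - p) ^ m * #A := by
  induction m with
  | zero => exact ⟨∅, by simp, by simp, by simp⟩
  | succ m ih =>
    obtain ⟨S, hSX, hSm, hS⟩ := ih
    set B := {a ∈ A | ∀ x ∈ S, ¬ r a x} with hB
    obtain ⟨x, hxX, hx⟩ : ∃ x ∈ X, p * #B ≤ (#{a ∈ B | r a x} : ℝ) := by
      refine exists_le_of_sum_le hX ?_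
      have hcount : ∑ a ∈ B, #{x ∈ X | r a x} = ∑ x ∈ X, #{a ∈ B | r a x} :=
        sum_card_bipartiteAbove_eq_sum_card_bipartiteBelow r
      calc ∑ _x ∈ X, p * (#B : ℝ) = ∑ _a ∈ B, p * (#X : ℝ) := by
            simp only [sum_const, nsmul_eq_mul]; ring
        _ ≤ ∑ a ∈ B, (#{x ∈ X | r a x} : ℝ) :=
            sum_le_sum fun a ha => h a (mem_filter.1 ha).1
        _ = _ := by exact_mod_cast hcount
    refine ⟨insert x S, insert_subset hxX hSX, (card_insert_le _ _).trans (by lia), ?_⟩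
    have hrest : {a ∈ A | ∀ y ∈ insert x S, ¬ r a y} = {a ∈ B | ¬ r a x} := by
      ext a
      simp only [hB, mem_filter, mem_insert, forall_eq_or_imp]
      tauto
    have hsplit : (#{a ∈ B | r a x} : ℝ) + #{a ∈ B | ¬ r a x} = #B := by
      exact_mod_cast card_filter_add_card_filter_not (s := B) (fun a => r a x)
    rw [hrest, pow_succ]
    nlinarith [mul_le_mul_of_nonneg_left hS (sub_nonneg.2 hp1)]

theorem two_mul_choose_le_choose_add_choose_sub (h n t : ℕ) (ht : t ≤ h) :
    2 * h.choose n ≤ (h + t).choose n + (h - t).choose n := by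
  induction t with
  | zero => simp [two_mul]
  | succ t ih =>
    refine (ih (by lia)).trans ?_
    obtain ⟨s, rfl⟩ : ∃ s, h = s + t + 1 := ⟨h - t - 1, by lia⟩
    rw [show s + t + 1 - t = s + 1 by lia, show s + t + 1 - (t + 1) = s by lia,
      show s + t + 1 + (t + 1) = (s + t + 1 + t) + 1 by lia]
    cases n with
    | zero => simp
    | succ n =>
      rw [Nat.choose_succ_succ s, Nat.choose_succ_succ (s + t + 1 + t)]
      have := Nat.choose_le_choose n (show s ≤ s + t + 1 + t by lia)
      lia

theorem two_mul_choose_le_of_add_eq {h n a b : ℕ} (hab : a + b = 2 * h) :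
    2 * h.choose n ≤ a.choose n + b.choose n := by
  wlog hle : b ≤ a generalizing a b
  · rw [add_comm]
    exact this (by lia) (by lia)
  · have := two_mul_choose_le_choose_add_choose_sub h n (a - h) (by lia)
    rwa [show h + (a - h) = a by lia, show h - (a - h) = b by lia] at this

open Finset in
theorem two_mul_choose_le_card_monochromatic {V : Type*} [Fintype V] [DecidableEq V] {h n : ℕ}
    (hV : Fintype.card V = 2 * h) (hn : n ≠ 0) (c : V → Bool) :
    2 * h.choose n ≤
      #{e ∈ powersetCard n (univ : Finset V) | ∀ v ∈ e, ∀ w ∈ e, c v = c w} := by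
  set T : Bool → Finset V := fun b => {v | c v = b}
  have hT : #(T true) + #(T false) = 2 * h := by
    rw [← hV, ← card_univ, ← card_filter_add_card_filter_not (s := univ) (fun v => c v = true)]
    simp [T]
  have hdisj : Disjoint (powersetCard n (T true)) (powersetCard n (T false)) := by
    refine disjoint_left.2 fun e he he' => ?_
    rw [mem_powersetCard] at he he'
    obtain ⟨v, hv⟩ : e.Nonempty := card_ne_zero.1 (he.2 ▸ hn)
    have h1 := he.1 hv
    have h2 := he'.1 hv
    simp [T] at h1 h2
    simp [h1] at h2
  refine (two_mul_choose_le_of_add_eq hT).trans ?_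
  rw [← card_powersetCard, ← card_powersetCard, ← card_union_of_disjoint hdisj]
  refine card_le_card fun e he => ?_
  obtain ⟨b, he⟩ : ∃ b, e ∈ powersetCard n (T b) := by
    rcases mem_union.1 he with he | he <;> exact ⟨_, he⟩
  rw [mem_powersetCard] at he
  refine mem_filter.2 ⟨mem_powersetCard.2 ⟨subset_univ _, he.2⟩, fun v hv w hw => ?_⟩
  rw [(mem_filter.1 (he.1 hv)).2, (mem_filter.1 (he.1 hw)).2]

theorem descFactorial_two_mul_le {h n j : ℕ} (hnh : n < h) (hj : j ≤ n) :
    ((2 * h).descFactorial j : ℝ) ≤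
      2 ^ j * Real.exp ((j : ℝ) ^ 2 / (4 * ((h : ℝ) - n))) * h.descFactorial j := by
  induction j with
  | zero => simp
  | succ j ih =>
    have hD : (0 : ℝ) < (h : ℝ) - n := sub_pos.2 (by exact_mod_cast hnh)
    have hjn : (j : ℝ) + 1 ≤ n := by exact_mod_cast hj
    rw [Nat.descFactorial_succ, Nat.descFactorial_succ, Nat.cast_mul, Nat.cast_mul,
      Nat.cast_sub (by lia), Nat.cast_sub (by lia)]
    push_cast
    have hfac : 2 * (h : ℝ) - j ≤ 2 * Real.exp (j / (2 * ((h : ℝ) - n))) * (h - j) := by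
      have hexp := Real.add_one_le_exp ((j : ℝ) / (2 * ((h : ℝ) - n)))
      have hjD : (j : ℝ) = 2 * (j / (2 * ((h : ℝ) - n))) * (h - n) := by field_simp
      have hnn : (0 : ℝ) ≤ j / (2 * ((h : ℝ) - n)) := by positivity
      nlinarith [mul_le_mul_of_nonneg_right hexp (show (0 : ℝ) ≤ (h : ℝ) - j by linarith),
        mul_nonneg hnn (show (0 : ℝ) ≤ (n : ℝ) - j by linarith)]
    have hexp : Real.exp (j / (2 * ((h : ℝ) - n))) * Real.exp ((j : ℝ) ^ 2 / (4 * ((h : ℝ) - n)))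
        ≤ Real.exp (((j : ℝ) + 1) ^ 2 / (4 * ((h : ℝ) - n))) := by
      rw [← Real.exp_add, Real.exp_le_exp,
        show (j : ℝ) / (2 * ((h : ℝ) - n)) = 2 * j / (4 * ((h : ℝ) - n)) by field_simp; ring,
        ← add_div]
      gcongr
      linarith
    have hhj : (0 : ℝ) ≤ (h : ℝ) - j := by linarith
    calc (2 * (h : ℝ) - j) * (2 * h).descFactorial j
        ≤ (2 * Real.exp (j / (2 * ((h : ℝ) - n))) * (h - j)) *
          (2 ^ j * Real.exp ((j : ℝ) ^ 2 / (4 * ((h : ℝ) - n))) * h.descFactorial j) :=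
          mul_le_mul hfac (ih (by lia)) (by positivity) (by positivity)
      _ = 2 ^ (j + 1) * (Real.exp (j / (2 * ((h : ℝ) - n))) *
          Real.exp ((j : ℝ) ^ 2 / (4 * ((h : ℝ) - n)))) * ((h - j) * h.descFactorial j) := by ring
      _ ≤ _ := by gcongr

theorem choose_two_mul_le {h n : ℕ} (hnh : n < h) :
    ((2 * h).choose n : ℝ) ≤
      2 ^ n * Real.exp ((n : ℝ) ^ 2 / (4 * ((h : ℝ) - n))) * h.choose n := by
  have := descFactorial_two_mul_le hnh le_rfl
  rw [Nat.descFactorial_eq_factorial_mul_choose, Nat.descFactorial_eq_factorial_mul_choose] at this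
  push_cast at this
  have hf : (0 : ℝ) < n.factorial := by positivity
  exact le_of_mul_le_mul_left (by linarith) hf

open Finset in
theorem exists_uniform_not_two_colourable {V : Type*} [Fintype V] {h n m : ℕ}
    (hV : Fintype.card V = 2 * h) (hn : n ≠ 0) (hnh : n ≤ h)
    (hm : 2 * h * Real.log 2 * (2 * h).choose n / (2 * h.choose n) < m) :
    ∃ E : Finset (Finset V), (∀ e ∈ E, #e = n) ∧ #E ≤ m ∧
      ∀ c : V → Bool, ∃ e ∈ E, ∀ v ∈ e, ∀ w ∈ e, c v = c w := by
  classical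
  have hc : (0 : ℝ) < h.choose n := by exact_mod_cast Nat.choose_pos hnh
  have hC : (0 : ℝ) < (2 * h).choose n := by exact_mod_cast Nat.choose_pos (by lia)
  set p : ℝ := 2 * h.choose n / (2 * h).choose n with hp
  have hcardX : #(powersetCard n (univ : Finset V)) = (2 * h).choose n := by simp [hV]
  have hX : (powersetCard n (univ : Finset V)).Nonempty :=
    powersetCard_nonempty.2 (by simp [hV]; lia)
  have hmono (c : V → Bool) := two_mul_choose_le_card_monochromatic hV hn c
  have hp1 : p ≤ 1 := by
    rw [hp, div_le_one hC]
    have := (hmono fun _ => true).trans (card_filter_le _ _)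
    rw [hcardX] at this
    exact_mod_cast this
  obtain ⟨S, hSX, hSm, hS⟩ := exists_greedy_cover (univ : Finset (V → Bool))
    (powersetCard n univ) hX (fun c e => ∀ v ∈ e, ∀ w ∈ e, c v = c w) hp1
    (fun c _ => by
      rw [hcardX, hp, div_mul_cancel₀ _ hC.ne']
      exact_mod_cast hmono c) m
  refine ⟨S, fun e he => (mem_powersetCard.1 (hSX he)).2, hSm, fun c => ?_⟩
  have hlt : (1 - p) ^ m * (2 : ℝ) ^ (2 * h) < 1 := by
    have hpm : 2 * h * Real.log 2 < m * p := by
      rw [div_lt_iff₀ (by positivity)] at hm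
      rw [hp, ← mul_div_assoc, lt_div_iff₀ hC]
      exact hm
    calc (1 - p) ^ m * (2 : ℝ) ^ (2 * h)
        ≤ Real.exp (-p) ^ m * Real.exp (Real.log 2) ^ (2 * h) := by
          rw [Real.exp_log two_pos]
          gcongr
          exact Real.one_sub_le_exp_neg p
      _ = Real.exp (2 * h * Real.log 2 - m * p) := by
          rw [← Real.exp_nat_mul, ← Real.exp_nat_mul, ← Real.exp_add]
          push_cast
          ring_nf
      _ < 1 := Real.exp_lt_one_iff.2 (by linarith)
  by_contra! hcon
  simp only [card_univ, Fintype.card_fun, Fintype.card_bool, hV, Nat.cast_pow,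
    Nat.cast_ofNat] at hS
  refine absurd (hS.trans_lt hlt) (not_lt.2 (Nat.one_le_cast.2 (card_pos.2 ⟨c, ?_⟩)))
  simpa using hcon

open Filter Topology in
theorem eventually_exp_sq_div_le {δ : ℝ} (hδ : 0 < δ) :
    ∀ᶠ n : ℕ in atTop, Real.exp ((n : ℝ) ^ 2 / (4 * (((n ^ 2 / 4 : ℕ) : ℝ) - n))) ≤
      (1 + δ) * Real.exp 1 := by
  have hlog : 0 < Real.log (1 + δ) := Real.log_pos (by linarith)
  obtain ⟨K, hK⟩ := exists_nat_gt (9 / Real.log (1 + δ))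
  filter_upwards [eventually_ge_atTop (K + 9)] with n hn
  have hnK : (K : ℝ) + 9 ≤ n := by exact_mod_cast hn
  rw [div_lt_iff₀ hlog] at hK
  have hK0 : (0 : ℝ) ≤ K := K.cast_nonneg
  have hfloor : (n : ℝ) ^ 2 ≤ 4 * ((n ^ 2 / 4 : ℕ) : ℝ) + 3 := by
    exact_mod_cast (show n ^ 2 ≤ 4 * (n ^ 2 / 4) + 3 by lia)
  rw [← Real.exp_log (show 0 < 1 + δ by linarith), ← Real.exp_add, Real.exp_le_exp,
    div_le_iff₀ (by nlinarith)]
  have hlin : 9 ≤ Real.log (1 + δ) * (n - 5) := by nlinarith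
  nlinarith [mul_le_mul_of_nonneg_right hlin (show (0 : ℝ) ≤ n by linarith),
    mul_le_mul_of_nonneg_left hfloor (show 0 ≤ Real.log (1 + δ) + 1 by linarith)]

/-- The Erdős upper bound `m(n) ≤ (1+o(1)) · (e ln 2 / 4) · n² · 2^n`: for every `ε > 0`
there is `N` such that for every `n ≥ N` there is an `n`-uniform hypergraph with at most
`(1+ε)·(e·ln 2/4)·n²·2^n` edges admitting no proper 2-colouring. -/
theorem erdos_upper_bound :
    ∀ ε : ℝ, 0 < ε → ∃ N : ℕ, ∀ n : ℕ, N ≤ n →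
      ∃ (V : Type) (_ : Fintype V) (E : Finset (Finset V)),
        (∀ e ∈ E, e.card = n) ∧
        (E.card : ℝ) ≤ (1 + ε) * (Real.exp 1 * Real.log 2 / 4) * (n : ℝ) ^ 2 * 2 ^ n ∧
        (∀ c : V → Bool, ∃ e ∈ E, ∀ v ∈ e, ∀ w ∈ e, c v = c w) := by
  intro ε hε
  have hlog : 0 < Real.log 2 := Real.log_pos one_lt_two
  obtain ⟨N, hN⟩ := Filter.eventually_atTop.1 (eventually_exp_sq_div_le (half_pos hε))
  obtain ⟨M, hM⟩ := exists_nat_gt (1 / (ε / 2 * (Real.exp 1 * Real.log 2 / 4)))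
  refine ⟨N + M + 9, fun n hn => ?_⟩
  set h := n ^ 2 / 4 with hh
  have hnh : n < h := by
    rw [hh, Nat.lt_iff_add_one_le, Nat.le_div_iff_mul_le (by norm_num)]
    nlinarith
  have hc : (0 : ℝ) < h.choose n := by exact_mod_cast Nat.choose_pos hnh.le
  obtain ⟨E, hE, hEm, hcol⟩ := exists_uniform_not_two_colourable
    (Fintype.card_fin (2 * h)) (by lia) hnh.le
    (Nat.lt_floor_add_one (2 * h * Real.log 2 * (2 * h).choose n / (2 * h.choose n)) |>.trans_eq
      (Nat.cast_succ _).symm)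
  refine ⟨Fin (2 * h), inferInstance, E, hE, ?_, hcol⟩
  have hratio : ((2 * h).choose n : ℝ) ≤
      2 ^ n * ((1 + ε / 2) * Real.exp 1) * h.choose n :=
    (choose_two_mul_le hnh).trans (by gcongr; exact hN n (by lia))
  have h4 : 4 * (h : ℝ) ≤ (n : ℝ) ^ 2 := by
    exact_mod_cast (show 4 * h ≤ n ^ 2 by lia)
  have hmain : 2 * h * Real.log 2 * (2 * h).choose n / (2 * h.choose n) ≤
      (1 + ε / 2) * (Real.exp 1 * Real.log 2 / 4) * (n : ℝ) ^ 2 * 2 ^ n := by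
    rw [div_le_iff₀ (by positivity)]
    calc 2 * h * Real.log 2 * (2 * h).choose n
        ≤ 2 * ((n : ℝ) ^ 2 / 4) * Real.log 2 *
          (2 ^ n * ((1 + ε / 2) * Real.exp 1) * h.choose n) := by
          gcongr
          linarith
      _ = _ := by ring
  have hone : 1 ≤ ε / 2 * (Real.exp 1 * Real.log 2 / 4) * (n : ℝ) ^ 2 * 2 ^ n := by
    rw [div_lt_iff₀ (by positivity)] at hM
    have hMn : (M : ℝ) ≤ (n : ℝ) ^ 2 := by
      exact_mod_cast (show M ≤ n ^ 2 by nlinarith)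
    have hpow : (1 : ℝ) ≤ 2 ^ n := one_le_pow₀ one_le_two
    have hle : 1 ≤ ε / 2 * (Real.exp 1 * Real.log 2 / 4) * (n : ℝ) ^ 2 := by
      rw [mul_comm]
      exact hM.le.trans (by gcongr)
    nlinarith
  have hfl := Nat.floor_le
    (show 0 ≤ 2 * h * Real.log 2 * (2 * h).choose n / (2 * h.choose n : ℝ) by positivity)
  have hEm' : (E.card : ℝ) ≤
      ⌊2 * h * Real.log 2 * (2 * h).choose n / (2 * h.choose n : ℝ)⌋₊ + 1 := by
    exact_mod_cast hEm
  linarith
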